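/- For every n : ℕ, the number of neutral λ-terms of natural size n+1 equals the n-th Motzkin number, i.e. Nat.card {t : Term // Neutral t ∧ size t = n+1} = ∑_{k=0}^{⌊n/2⌋} C(n, 2k) · catalan k. In particular there is a size-preserving (up to the shift by one) bijection between Motzkin trees with n nodes and neutral λ-terms of size n+1. -/

import Mathlib

inductive Term : Type
  | idx : ℕ → Term
  | app : Term → Term → Term
  | abs : Term → Term

def Term.size : Term → ℕ
  | .idx n => n + 1
  | .app t u => t.size + u.size + 1
  | .abs t => t.size + 1

namespace Lambda

mutual
  inductive Neutral : Term → Prop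
    | idx (n : ℕ) : Neutral (.idx n)
    | app {t u : Term} : Neutral t → Normal u → Neutral (.app t u)
  inductive Normal : Term → Prop
    | of {t : Term} : Neutral t → Normal t
    | abs {t : Term} : Normal t → Normal (.abs t)
end

open Finset hiding antidiagonal mem_antidiagonal
open HasAntidiagonal (antidiagonal mem_antidiagonal)

theorem sum_antidiagonal_choose_mul_choose (n p q : ℕ) :
    ∑ x ∈ antidiagonal n, x.1.choose p * x.2.choose q = (n + 1).choose (p + q + 1) := by
  induction n generalizing p with
  | zero => cases p <;> cases q <;> simp [Nat.choose_eq_zero_of_lt]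
  | succ n ih =>
    rw [Nat.sum_antidiagonal_succ]
    cases p with
    | zero =>
      have h := ih 0
      simp only [Nat.choose_zero_right, one_mul, zero_add] at h ⊢
      rw [h, Nat.choose_succ_succ (n + 1)]
    | succ p =>
      simp only [Nat.choose_succ_succ _ p, add_mul, sum_add_distrib, ih, Nat.choose_zero_succ,
        zero_mul, zero_add]
      rw [show p + 1 + q + 1 = (p + q + 1) + 1 by ring, Nat.choose_succ_succ (n + 1)]

/-- The `n`-th Motzkin number. -/
def motzkin (n : ℕ) : ℕ :=
  ∑ k ∈ range (n / 2 + 1), n.choose (2 * k) * catalan k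

theorem motzkin_eq_sum_range {n N : ℕ} (h : n < 2 * N) :
    motzkin n = ∑ k ∈ range N, n.choose (2 * k) * catalan k := by
  refine sum_subset (range_subset_range.2 (by omega)) fun k _ hk => ?_
  rw [mem_range] at hk
  rw [Nat.choose_eq_zero_of_lt (by omega), zero_mul]

theorem sum_antidiagonal_motzkin_mul_motzkin (n : ℕ) :
    ∑ x ∈ antidiagonal n, motzkin x.1 * motzkin x.2 =
      ∑ k ∈ range (n + 1), (n + 1).choose (2 * k + 1) * catalan (k + 1) := by
  have expand : ∀ x ∈ antidiagonal n, motzkin x.1 * motzkin x.2 =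
      ∑ y ∈ range (n + 1) ×ˢ range (n + 1),
        catalan y.1 * catalan y.2 * (x.1.choose (2 * y.1) * x.2.choose (2 * y.2)) := by
    intro x hx
    rw [mem_antidiagonal] at hx
    rw [motzkin_eq_sum_range (n := x.1) (N := n + 1) (by omega),
      motzkin_eq_sum_range (n := x.2) (N := n + 1) (by omega), sum_mul_sum, sum_product]
    exact sum_congr rfl fun a _ => sum_congr rfl fun b _ => by ring
  rw [sum_congr rfl expand, sum_comm]
  simp only [← mul_sum, sum_antidiagonal_choose_mul_choose]
  rw [← sum_filter_of_ne (p := fun y : ℕ × ℕ => y.1 + y.2 ∈ range (n + 1)),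
    ← sum_fiberwise_of_maps_to (g := fun y : ℕ × ℕ => y.1 + y.2) (t := range (n + 1))
      fun y hy => (mem_filter.1 hy).2]
  · refine sum_congr rfl fun k hk => ?_
    rw [mem_range] at hk
    rw [catalan_succ', mul_sum]
    refine sum_congr ?_ ?_
    · ext y
      simp only [mem_filter, mem_product, mem_range, mem_antidiagonal]
      omega
    · intro y hy
      rw [mem_antidiagonal] at hy
      rw [← hy, mul_add, mul_comm]
  · intro y _ hy
    contrapose! hy
    rw [mem_range] at hy
    rw [Nat.choose_eq_zero_of_lt (by omega), mul_zero]

theorem motzkin_add_two (n : ℕ) :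
    motzkin (n + 2) =
      motzkin (n + 1) + ∑ x ∈ antidiagonal n, motzkin x.1 * motzkin x.2 := by
  rw [sum_antidiagonal_motzkin_mul_motzkin, motzkin_eq_sum_range (N := n + 1 + 1) (by omega),
    motzkin_eq_sum_range (n := n + 1) (N := n + 1 + 1) (by omega), sum_range_succ',
    sum_range_succ' _ (n + 1)]
  simp only [mul_add, mul_one, Nat.choose_succ_succ (n + 1), add_mul, sum_add_distrib, mul_zero,
    Nat.choose_zero_right]
  ring

theorem not_neutral_abs (t : Term) : ¬ Neutral (.abs t) := nofun

/-- The neutral terms of size `n + 1`. -/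
abbrev NeutralOfSize (n : ℕ) : Type := {t : Term // Neutral t ∧ t.size = n + 1}

/-- Add one successor to the index, or one abstraction to the argument, at the root of a term. -/
def bump : Term → Term
  | .idx n => .idx (n + 1)
  | .app t u => .app t (.abs u)
  | .abs t => .abs t

theorem bump_injective : Function.Injective bump := by
  intro t u h
  cases t <;> cases u <;> simp_all [bump]

theorem Neutral.bump {t : Term} (h : Neutral t) : Neutral (bump t) := by
  cases h with
  | idx n => exact .idx (n + 1)
  | app ht hu => exact .app ht (.abs hu)

theorem Neutral.size_bump {t : Term} (h : Neutral t) : (Lambda.bump t).size = t.size + 1 := by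
  cases h <;> simp [Lambda.bump, Term.size]; omega

theorem size_pos (t : Term) : 0 < t.size := by
  cases t <;> simp [Term.size]

theorem bump_ne_app {t u v : Term} (hv : Neutral v) : bump t ≠ .app u v := by
  cases t <;> simp [bump]
  rintro rfl rfl
  exact not_neutral_abs _ hv

/-- The combinatorial step: a neutral term of size at least `3` is either a bumped neutral term or
the application of a neutral term to a neutral term. -/
def neutralStep (n : ℕ) :
    NeutralOfSize (n + 1) ⊕
      (Σ x : antidiagonal n, NeutralOfSize x.1.1 × NeutralOfSize x.1.2) →
    NeutralOfSize (n + 2)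
  | .inl t => ⟨bump t, t.2.1.bump, by rw [t.2.1.size_bump, t.2.2]⟩
  | .inr ⟨x, t, u⟩ => ⟨.app t u, .app t.2.1 (.of u.2.1), by
      have := mem_antidiagonal.1 x.2
      rw [Term.size, t.2.2, u.2.2]
      omega⟩

theorem neutralStep_injective (n : ℕ) : Function.Injective (neutralStep n) := by
  rintro (⟨t, ht⟩ | ⟨⟨⟨a, b⟩, hx⟩, ⟨t, ht⟩, ⟨u, hu⟩⟩)
    (⟨t', ht'⟩ | ⟨⟨⟨a', b'⟩, hx'⟩, ⟨t', ht'⟩, ⟨u', hu'⟩⟩) h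
  · have := bump_injective (congrArg Subtype.val h)
    subst this
    rfl
  · exact (bump_ne_app hu'.1 (congrArg Subtype.val h)).elim
  · exact (bump_ne_app hu.1 (congrArg Subtype.val h).symm).elim
  · obtain ⟨rfl, rfl⟩ := Term.app.inj (congrArg Subtype.val h)
    obtain rfl : a = a' := by have := ht.2.symm.trans ht'.2; simpa using this
    obtain rfl : b = b' := by have := hu.2.symm.trans hu'.2; simpa using this
    rfl

theorem neutralStep_surjective (n : ℕ) : Function.Surjective (neutralStep n) := by
  rintro ⟨t, ht, hs⟩
  cases ht with
  | idx k =>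
    obtain rfl : k = n + 2 := by simpa [Term.size] using hs
    exact ⟨.inl ⟨.idx (n + 1), .idx _, rfl⟩, rfl⟩
  | @app t u ht hu =>
    rw [Term.size] at hs
    have ht0 := size_pos t
    cases hu with
    | of hu =>
      have hu0 := size_pos u
      exact ⟨.inr ⟨⟨(t.size - 1, u.size - 1), by rw [mem_antidiagonal]; omega⟩,
        ⟨t, ht, by dsimp only; omega⟩, ⟨u, hu, by dsimp only; omega⟩⟩, rfl⟩
    | @abs u hu =>
      rw [Term.size] at hs
      exact ⟨.inl ⟨.app t u, .app ht hu, by rw [Term.size]; omega⟩, rfl⟩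

theorem eq_idx_of_size_le_two {t : Term} (h : Neutral t) (hs : t.size ≤ 2) :
    t = .idx (t.size - 1) := by
  cases h with
  | idx k => rfl
  | @app t u ht hu =>
    have := size_pos t
    have := size_pos u
    rw [Term.size] at hs
    omega

/-- There is exactly one neutral term of size `1` and one of size `2`, an index each. -/
abbrev uniqueNeutralOfSize {n : ℕ} (hn : n ≤ 1) : Unique (NeutralOfSize n) where
  default := ⟨.idx n, .idx n, rfl⟩
  uniq t := Subtype.ext <| by
    rw [eq_idx_of_size_le_two t.2.1 (by have := t.2.2; omega), t.2.2, Nat.add_sub_cancel]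

theorem finite_and_card_neutralOfSize (n : ℕ) :
    Finite (NeutralOfSize n) ∧ Nat.card (NeutralOfSize n) = motzkin n := by
  induction n using Nat.strong_induction_on with
  | _ n ih =>
    match n, ih with
    | 0, _ =>
      have := uniqueNeutralOfSize (n := 0) (by omega)
      exact ⟨inferInstance, by simp [motzkin]⟩
    | 1, _ =>
      have := uniqueNeutralOfSize (n := 1) (by omega)
      exact ⟨inferInstance, by simp [motzkin]⟩
    | n + 2, ih =>
      have bij : Function.Bijective (neutralStep n) :=
        ⟨neutralStep_injective n, neutralStep_surjective n⟩
      have : Finite (NeutralOfSize (n + 1)) := (ih (n + 1) (by omega)).1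
      have ih₁ : ∀ x : antidiagonal n, Finite (NeutralOfSize x.1.1) ∧ _ := fun x =>
        ih x.1.1 (by have := mem_antidiagonal.1 x.2; omega)
      have ih₂ : ∀ x : antidiagonal n, Finite (NeutralOfSize x.1.2) ∧ _ := fun x =>
        ih x.1.2 (by have := mem_antidiagonal.1 x.2; omega)
      have := fun x => (ih₁ x).1
      have := fun x => (ih₂ x).1
      refine ⟨Finite.of_surjective _ bij.2, ?_⟩
      rw [← Nat.card_congr (Equiv.ofBijective _ bij), Nat.card_sum, Nat.card_sigma,
        (ih (n + 1) (by omega)).2, motzkin_add_two, ← sum_coe_sort (antidiagonal n)]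
      simp only [Nat.card_prod, (ih₁ _).2, (ih₂ _).2]

theorem neutral_eq_motzkin :
    ∀ n : ℕ, Nat.card {t : Term // Neutral t ∧ t.size = n + 1}
      = ∑ k ∈ Finset.range (n / 2 + 1), n.choose (2 * k) * catalan k :=
  fun n => (finite_and_card_neutralOfSize n).2

end Lambda
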